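/- arXiv:1611.04738 — 10 statements merged into one kernel-verified Lean document; each statement's English description precedes it below -/
import Mathlib

section
/- Let V and V' be finitely generated free abelian groups, B : V × V' → ℤ a unimodular bilinear pairing, and j : V → V' a homomorphism whose image im j is a direct summand of V' and which satisfies {x ∈ V : B(x, w) = 0 for all w ∈ im j} = ker j. Then there exists a 1-homomorphism t : V' → V, i.e. a homomorphism with V = ker j ⊕ im t, j ∘ t ∘ j = j and t ∘ j ∘ t = t. (Lemma 3.9(a) of the paper.) -/
/-- A linear map `j` and a reflexive generalized inverse `t` of it split the domain of `j`. -/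
theorem LinearMap.isCompl_ker_range_of_comp_comp_eq {R M N : Type*} [Ring R]
    [AddCommGroup M] [AddCommGroup N] [Module R M] [Module R N]
    {j : M →ₗ[R] N} {t : N →ₗ[R] M} (hj : j ∘ₗ (t ∘ₗ j) = j) (ht : t ∘ₗ (j ∘ₗ t) = t) :
    IsCompl (LinearMap.ker j) (LinearMap.range t) := by
  constructor
  · rw [Submodule.disjoint_def]
    rintro _ hx ⟨y, rfl⟩
    rw [← LinearMap.congr_fun ht y]
    simp [LinearMap.mem_ker.mp hx]
  · rw [codisjoint_iff, Submodule.eq_top_iff']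
    intro x
    refine Submodule.mem_sup.mpr ⟨x - t (j x), ?_, t (j x), ⟨j x, rfl⟩, sub_add_cancel _ _⟩
    have h : j (t (j x)) = j x := LinearMap.congr_fun hj x
    simp [h]

/-- A linear map whose range is projective and complemented has a reflexive generalized inverse. -/
theorem LinearMap.exists_comp_comp_eq_of_isCompl_range {R M N : Type*} [Ring R]
    [AddCommGroup M] [AddCommGroup N] [Module R M] [Module R N]
    {j : M →ₗ[R] N} [Module.Projective R (LinearMap.range j)] {C : Submodule R N}
    (hC : IsCompl (LinearMap.range j) C) :
    ∃ t : N →ₗ[R] M, j ∘ₗ (t ∘ₗ j) = j ∧ t ∘ₗ (j ∘ₗ t) = t := by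
  obtain ⟨s, hs⟩ := j.rangeRestrict.exists_rightInverse_of_surjective j.range_rangeRestrict
  have hjs : ∀ y, j (s y) = y := fun y ↦ congrArg Subtype.val (LinearMap.congr_fun hs y)
  have hp := Submodule.projectionOnto_apply_left hC
  refine ⟨s ∘ₗ Submodule.projectionOnto _ C hC, ?_, ?_⟩
  · ext x
    exact (hjs _).trans (congrArg Subtype.val (hp ⟨j x, x, rfl⟩))
  · ext y
    simp only [LinearMap.comp_apply, hjs, hp]

/-- Lemma 3.9(a): existence of a 1-homomorphism. -/
theorem stmt0 (V V' : Type) [AddCommGroup V] [AddCommGroup V']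
    [Module.Free ℤ V] [Module.Finite ℤ V] [Module.Free ℤ V'] [Module.Finite ℤ V']
    (B : V →ₗ[ℤ] V' →ₗ[ℤ] ℤ)
    (hB : Function.Bijective B) (hB' : Function.Bijective B.flip)
    (j : V →ₗ[ℤ] V')
    (hsum : ∃ C : Submodule ℤ V', IsCompl (LinearMap.range j) C)
    (hperp : ∀ x : V, (∀ w ∈ LinearMap.range j, B x w = 0) ↔ x ∈ LinearMap.ker j) :
    ∃ t : V' →ₗ[ℤ] V,
      IsCompl (LinearMap.ker j) (LinearMap.range t) ∧
      j ∘ₗ (t ∘ₗ j) = j ∧ t ∘ₗ (j ∘ₗ t) = t := by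
  obtain ⟨C, hC⟩ := hsum
  obtain ⟨t, hj, ht⟩ := LinearMap.exists_comp_comp_eq_of_isCompl_range hC
  exact ⟨t, LinearMap.isCompl_ker_range_of_comp_comp_eq hj ht, hj, ht⟩
end

section
/- Let V and V' be finitely generated free abelian groups, B : V × V' → ℤ a unimodular bilinear pairing, and j : V → V' a homomorphism whose image im j is a direct summand of V' and which satisfies {x ∈ V : B(x, w) = 0 for all w ∈ im j} = ker j. Let t : V' → V be a 1-homomorphism. Then there exists a unique homomorphism s : V' → V satisfying B(s(u), w) = B(t(u), j(t(w))) for all u, w ∈ V', and this s is a 2-homomorphism. (Lemma 3.9(b) of the paper: s = t* ∘ t, where t* : im t → V is defined by B(t*x, u) = B(x, j(t(u))) for all u ∈ V'.) -/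
/-- Lemma 3.9(b): from a 1-homomorphism `t`, the map `s = t* ∘ t` is the unique homomorphism
with `B (s u) w = B (t u) (j (t w))`, and it is a 2-homomorphism. -/
theorem stmt1 (V V' : Type) [AddCommGroup V] [AddCommGroup V']
    [Module.Free ℤ V] [Module.Finite ℤ V] [Module.Free ℤ V'] [Module.Finite ℤ V']
    (B : V →ₗ[ℤ] V' →ₗ[ℤ] ℤ)
    (hB : Function.Bijective B) (hB' : Function.Bijective B.flip)
    (j : V →ₗ[ℤ] V')
    (hsum : ∃ C : Submodule ℤ V', IsCompl (LinearMap.range j) C)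
    (hperp : ∀ x : V, (∀ w ∈ LinearMap.range j, B x w = 0) ↔ x ∈ LinearMap.ker j)
    (t : V' →ₗ[ℤ] V)
    (ht1 : IsCompl (LinearMap.ker j) (LinearMap.range t))
    (ht2 : j ∘ₗ (t ∘ₗ j) = j) (ht3 : t ∘ₗ (j ∘ₗ t) = t) :
    ∃ s : V' →ₗ[ℤ] V,
      (∀ u w : V', B (s u) w = B (t u) (j (t w))) ∧
      IsCompl (LinearMap.ker j) (LinearMap.range s) ∧
      (∀ x ∈ LinearMap.range s, ∀ v : V', B x (j (s v)) = B x v) ∧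
      (∀ s' : V' →ₗ[ℤ] V, (∀ u w : V', B (s' u) w = B (t u) (j (t w))) → s' = s) := by
  obtain ⟨s, hs⟩ : ∃ s : V' →ₗ[ℤ] V, ∀ u w : V', B (s u) w = B (t u) (j (t w)) :=
    ⟨(LinearEquiv.ofBijective B hB).symm ∘ₗ B.compl₁₂ t (j ∘ₗ t), fun u w =>
      LinearMap.congr_fun ((LinearEquiv.ofBijective B hB).apply_symm_apply
        (B.compl₁₂ t (j ∘ₗ t) u)) w⟩
  have hjtj (x : V) : j (t (j x)) = j x := LinearMap.congr_fun ht2 x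
  have hjs (v : V') : j (s v) = j (t v) := by
    rw [← sub_eq_zero, ← map_sub, ← LinearMap.mem_ker, ← hperp]
    rintro _ ⟨y, rfl⟩
    rw [map_sub, LinearMap.sub_apply, hs, hjtj, sub_self]
  have hts (v : V') (hv : j (s v) = 0) : s v = 0 := by
    have htv : t v = 0 := by
      have h := LinearMap.congr_fun ht3 v
      simp only [LinearMap.comp_apply, ← hjs, hv, map_zero] at h
      exact h.symm
    apply hB.injective
    ext w
    simp [hs, htv]
  refine ⟨s, hs, ⟨?_, ?_⟩, ?_, ?_⟩
  · rw [Submodule.disjoint_def]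
    rintro _ hx ⟨v, rfl⟩
    exact hts v hx
  · rw [codisjoint_iff, eq_top_iff]
    intro x _
    refine Submodule.mem_sup.2 ⟨x - s (j x), ?_, s (j x), ⟨j x, rfl⟩, sub_add_cancel _ _⟩
    rw [LinearMap.mem_ker, map_sub, hjs, hjtj, sub_self]
  · rintro _ ⟨u, rfl⟩ v
    rw [hs, hs, hjtj, hjs]
  · intro s' hs'
    ext u
    apply hB.injective
    ext w
    rw [hs', hs]
end

section
/- Let V and V' be finitely generated free abelian groups, B : V × V' → ℤ a unimodular bilinear pairing, and j : V → V' a homomorphism whose image im j is a direct summand of V' and which satisfies {x ∈ V : B(x, w) = 0 for all w ∈ im j} = ker j. If s : V' → V is a 2-homomorphism, then j ∘ s ∘ j = j. (Lemma 3.9(c1) of the paper.) -/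
/-- Lemma 3.9(c1): a 2-homomorphism `s` satisfies `j ∘ s ∘ j = j`. -/
theorem stmt2 (V V' : Type) [AddCommGroup V] [AddCommGroup V']
    [Module.Free ℤ V] [Module.Finite ℤ V] [Module.Free ℤ V'] [Module.Finite ℤ V']
    (B : V →ₗ[ℤ] V' →ₗ[ℤ] ℤ)
    (hB : Function.Bijective B) (hB' : Function.Bijective B.flip)
    (j : V →ₗ[ℤ] V')
    (hsum : ∃ C : Submodule ℤ V', IsCompl (LinearMap.range j) C)
    (hperp : ∀ x : V, (∀ w ∈ LinearMap.range j, B x w = 0) ↔ x ∈ LinearMap.ker j)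
    (s : V' →ₗ[ℤ] V)
    (hs1 : IsCompl (LinearMap.ker j) (LinearMap.range s))
    (hs2 : ∀ x ∈ LinearMap.range s, ∀ v : V', B x (j (s v)) = B x v) :
    j ∘ₗ (s ∘ₗ j) = j := by
  ext v
  apply hB'.1
  ext x
  obtain ⟨k, hk, y, hy, rfl⟩ :=
    Submodule.mem_sup.mp (hs1.sup_eq_top ▸ Submodule.mem_top : x ∈ _ ⊔ _)
  have h₁ := (hperp k).mpr hk (j (s (j v))) (LinearMap.mem_range_self j _)
  have h₂ := (hperp k).mpr hk (j v) (LinearMap.mem_range_self j _)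
  simp [h₁, h₂, hs2 y hy (j v)]
end

section
/- Let V and V' be finitely generated free abelian groups, B : V × V' → ℤ a unimodular bilinear pairing, and j : V → V' a homomorphism whose image im j is a direct summand of V' and which satisfies {x ∈ V : B(x, w) = 0 for all w ∈ im j} = ker j. If s : V' → V is a 2-homomorphism, then V' = im j ⊕ ker s. (Lemma 3.9(c2) of the paper.) -/
/-- Lemma 3.9(c2): for a 2-homomorphism `s`, one has `V' = im j ⊕ ker s`. -/
theorem stmt3 (V V' : Type) [AddCommGroup V] [AddCommGroup V']
    [Module.Free ℤ V] [Module.Finite ℤ V] [Module.Free ℤ V'] [Module.Finite ℤ V']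
    (B : V →ₗ[ℤ] V' →ₗ[ℤ] ℤ)
    (hB : Function.Bijective B) (hB' : Function.Bijective B.flip)
    (j : V →ₗ[ℤ] V')
    (hsum : ∃ C : Submodule ℤ V', IsCompl (LinearMap.range j) C)
    (hperp : ∀ x : V, (∀ w ∈ LinearMap.range j, B x w = 0) ↔ x ∈ LinearMap.ker j)
    (s : V' →ₗ[ℤ] V)
    (hs1 : IsCompl (LinearMap.ker j) (LinearMap.range s))
    (hs2 : ∀ x ∈ LinearMap.range s, ∀ v : V', B x (j (s v)) = B x v) :
    IsCompl (LinearMap.range j) (LinearMap.ker s) := by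
  have zero_of_orthogonal : ∀ w ∈ LinearMap.range j,
      (∀ x ∈ LinearMap.range s, B x w = 0) → w = 0 := by
    intro w hw h
    apply hB'.injective
    ext x
    obtain ⟨k, hk, y, hy, rfl⟩ := Submodule.mem_sup.mp
      (hs1.sup_eq_top ▸ Submodule.mem_top : x ∈ LinearMap.ker j ⊔ LinearMap.range s)
    simp [(hperp k).mpr hk w hw, h y hy]
  have s_j_s : ∀ v, s (j (s v)) = s v := by
    intro v
    rw [← sub_eq_zero]
    refine Submodule.disjoint_def.mp hs1.disjoint _ ?_ ⟨j (s v) - v, by simp⟩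
    rw [LinearMap.mem_ker]
    refine zero_of_orthogonal _ ⟨_, rfl⟩ fun x hx => ?_
    simp [hs2 x hx]
  constructor
  · refine Submodule.disjoint_def.mpr fun w hw hsw => zero_of_orthogonal w hw fun x hx => ?_
    rw [← hs2 x hx, LinearMap.mem_ker.mp hsw, map_zero, map_zero]
  · refine codisjoint_iff.mpr (eq_top_iff.mpr fun v _ => ?_)
    exact Submodule.mem_sup.mpr
      ⟨j (s v), ⟨_, rfl⟩, v - j (s v), by simp [s_j_s], add_sub_cancel _ _⟩
end

section
/- Let V and V' be finitely generated free abelian groups, B : V × V' → ℤ a unimodular bilinear pairing, and j : V → V' a homomorphism whose image im j is a direct summand of V' and which satisfies {x ∈ V : B(x, w) = 0 for all w ∈ im j} = ker j. If s : V' → V is a 2-homomorphism, then s ∘ j ∘ s = s. (Lemma 3.9(c3) of the paper.) -/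
/-- Lemma 3.9(c3): a 2-homomorphism `s` satisfies `s ∘ j ∘ s = s`. -/
theorem stmt4 (V V' : Type) [AddCommGroup V] [AddCommGroup V']
    [Module.Free ℤ V] [Module.Finite ℤ V] [Module.Free ℤ V'] [Module.Finite ℤ V']
    (B : V →ₗ[ℤ] V' →ₗ[ℤ] ℤ)
    (hB : Function.Bijective B) (hB' : Function.Bijective B.flip)
    (j : V →ₗ[ℤ] V')
    (hsum : ∃ C : Submodule ℤ V', IsCompl (LinearMap.range j) C)
    (hperp : ∀ x : V, (∀ w ∈ LinearMap.range j, B x w = 0) ↔ x ∈ LinearMap.ker j)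
    (s : V' →ₗ[ℤ] V)
    (hs1 : IsCompl (LinearMap.ker j) (LinearMap.range s))
    (hs2 : ∀ x ∈ LinearMap.range s, ∀ v : V', B x (j (s v)) = B x v) :
    s ∘ₗ (j ∘ₗ s) = s := by
  ext v
  have hsu (u : V') (hu : ∀ x ∈ LinearMap.range s, B x u = 0) : s u = 0 := by
    have hj : j (s u) = 0 := by
      apply hB'.injective
      rw [map_zero]
      ext x
      have hx : x ∈ LinearMap.ker j ⊔ LinearMap.range s := hs1.sup_eq_top ▸ Submodule.mem_top
      obtain ⟨y, hy, z, hz, rfl⟩ := Submodule.mem_sup.mp hx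
      have h₁ : B y (j (s u)) = 0 := (hperp y).mpr hy _ ⟨s u, rfl⟩
      have h₂ : B z (j (s u)) = 0 := (hs2 z hz u).trans (hu z hz)
      simp [h₁, h₂]
    exact Submodule.disjoint_def.mp hs1.disjoint _ hj ⟨u, rfl⟩
  have h := hsu (j (s v) - v) fun x hx => by rw [map_sub, hs2 x hx, sub_self]
  rw [map_sub] at h
  exact sub_eq_zero.mp h
end

section
/- Let V and V' be finitely generated free abelian groups, B : V × V' → ℤ a unimodular bilinear pairing, and j : V → V' a homomorphism whose image im j is a direct summand of V' and which satisfies {x ∈ V : B(x, w) = 0 for all w ∈ im j} = ker j. If s : V' → V is a 2-homomorphism and t : V' → V is any homomorphism with im t ⊆ im s and t ∘ j = s ∘ j, then t is a 1-homomorphism, i.e. V = ker j ⊕ im t, j ∘ t ∘ j = j and t ∘ j ∘ t = t. (Lemma 3.9(c4) of the paper.) -/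
/-- Lemma 3.9(c4): if `s` is a 2-homomorphism and `t` satisfies `im t ⊆ im s` and
`t ∘ j = s ∘ j`, then `t` is a 1-homomorphism. -/
theorem stmt5 (V V' : Type) [AddCommGroup V] [AddCommGroup V']
    [Module.Free ℤ V] [Module.Finite ℤ V] [Module.Free ℤ V'] [Module.Finite ℤ V']
    (B : V →ₗ[ℤ] V' →ₗ[ℤ] ℤ)
    (hB : Function.Bijective B) (hB' : Function.Bijective B.flip)
    (j : V →ₗ[ℤ] V')
    (hsum : ∃ C : Submodule ℤ V', IsCompl (LinearMap.range j) C)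
    (hperp : ∀ x : V, (∀ w ∈ LinearMap.range j, B x w = 0) ↔ x ∈ LinearMap.ker j)
    (s : V' →ₗ[ℤ] V)
    (hs1 : IsCompl (LinearMap.ker j) (LinearMap.range s))
    (hs2 : ∀ x ∈ LinearMap.range s, ∀ v : V', B x (j (s v)) = B x v)
    (t : V' →ₗ[ℤ] V)
    (ht1 : LinearMap.range t ≤ LinearMap.range s)
    (ht2 : t ∘ₗ j = s ∘ₗ j) :
    IsCompl (LinearMap.ker j) (LinearMap.range t) ∧
      j ∘ₗ (t ∘ₗ j) = j ∧ t ∘ₗ (j ∘ₗ t) = t := by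
  have hsj : ∀ v, j (s (j v)) = j v := by
    intro v
    rw [← sub_eq_zero]
    apply hB'.1
    ext x
    have hx : x ∈ LinearMap.ker j ⊔ LinearMap.range s := hs1.sup_eq_top ▸ Submodule.mem_top
    obtain ⟨k, hk, r, hr, rfl⟩ := Submodule.mem_sup.mp hx
    have hBk : B k (j (s (j v)) - j v) = 0 := (hperp k).mpr hk _ ⟨s (j v) - v, by simp⟩
    have hBr : B r (j (s (j v)) - j v) = 0 := by rw [map_sub, hs2 r hr, sub_self]
    simp only [LinearMap.flip_apply, map_zero, LinearMap.zero_apply, map_add,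
      hBk, hBr, add_zero]
  have htj : ∀ v, t (j v) = s (j v) := fun v => LinearMap.congr_fun ht2 v
  have hfix : ∀ x ∈ LinearMap.range s, t (j x) = x := by
    intro x hx
    rw [htj, ← sub_eq_zero]
    refine Submodule.disjoint_def.mp hs1.disjoint _ ?_ (sub_mem ⟨j x, rfl⟩ hx)
    rw [LinearMap.mem_ker, map_sub, hsj, sub_self]
  have hrange : LinearMap.range t = LinearMap.range s :=
    le_antisymm ht1 fun x hx => ⟨j x, hfix x hx⟩
  refine ⟨hrange ▸ hs1, ?_, ?_⟩
  · refine LinearMap.ext fun v => ?_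
    simp only [LinearMap.comp_apply, htj, hsj]
  · exact LinearMap.ext fun v => hfix (t v) (ht1 ⟨v, rfl⟩)
end

section
/- Let V₀ and V₁ be finitely generated free abelian groups, ∩ : V₀ × V₁ → ℤ a unimodular bilinear pairing, U an abelian group, and v₀ : U → V₀, v₁ : U → V₁ an elementary pair of monomorphisms. Then the induced pairing v₀(U) × (V₁ / v₁(U)) → ℤ, given by (v₀(u), w + v₁(U)) ↦ ∩(v₀(u), w), is well defined and unimodular. -/
/-- A surjection between finite free modules of the same rank is bijective. -/
theorem LinearMap.bijective_of_surjective_of_finrank_eq_of_free {R M N : Type*} [CommRing R]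
    [Nontrivial R] [AddCommGroup M] [Module R M] [AddCommGroup N] [Module R N]
    [Module.Free R M] [Module.Finite R M] [Module.Free R N] [Module.Finite R N]
    (f : M →ₗ[R] N) (hf : Function.Surjective f)
    (h : Module.finrank R M = Module.finrank R N) : Function.Bijective f := by
  let e : N ≃ₗ[R] M := LinearEquiv.ofFinrankEq N M h.symm
  have hs : Function.Surjective (e.toLinearMap ∘ₗ f) := e.surjective.comp hf
  have hi := OrzechProperty.injective_of_surjective_endomorphism _ hs
  exact ⟨fun x y hxy ↦ hi (congrArg e hxy), hf⟩


/-- Proof of the Modified Surgery Theorem 4.1: for an elementary pair `v₀, v₁`, the induced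
pairing `v₀(U) × (V₁ / v₁(U)) → ℤ` is well defined and unimodular. -/
theorem stmt7 (V₀ V₁ U : Type) [AddCommGroup V₀] [AddCommGroup V₁] [AddCommGroup U]
    [Module.Free ℤ V₀] [Module.Finite ℤ V₀]
    [Module.Free ℤ V₁] [Module.Finite ℤ V₁]
    (P : V₀ →ₗ[ℤ] V₁ →ₗ[ℤ] ℤ)
    (hP : Function.Bijective P) (hP' : Function.Bijective P.flip)
    (v₀ : U →ₗ[ℤ] V₀) (v₁ : U →ₗ[ℤ] V₁)
    (h₀inj : Function.Injective v₀) (h₁inj : Function.Injective v₁)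
    (horth : ∀ u u' : U, P (v₀ u) (v₁ u') = 0)
    (h₀sum : ∃ C : Submodule ℤ V₀, IsCompl (LinearMap.range v₀) C)
    (h₁sum : ∃ C : Submodule ℤ V₁, IsCompl (LinearMap.range v₁) C)
    (h₀rk : 2 * Module.finrank ℤ ↥(LinearMap.range v₀) = Module.finrank ℤ V₀)
    (h₁rk : 2 * Module.finrank ℤ ↥(LinearMap.range v₁) = Module.finrank ℤ V₁) :
    ∃ Q : ↥(LinearMap.range v₀) →ₗ[ℤ] (V₁ ⧸ LinearMap.range v₁) →ₗ[ℤ] ℤ,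
      (∀ (x : ↥(LinearMap.range v₀)) (w : V₁),
          Q x (Submodule.Quotient.mk w) = P (x : V₀) w) ∧
      Function.Bijective Q ∧ Function.Bijective Q.flip := by
  obtain ⟨C, hC⟩ := h₀sum
  obtain ⟨D, hD⟩ := h₁sum
  let Q : LinearMap.range v₀ →ₗ[ℤ] (V₁ ⧸ LinearMap.range v₁) →ₗ[ℤ] ℤ :=
    ((LinearMap.range v₁).liftQ (P.domRestrict (LinearMap.range v₀)).flip (by
      rintro _ ⟨u', rfl⟩
      ext ⟨_, u, rfl⟩
      exact horth u u')).flip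
  have hQ (x : LinearMap.range v₀) (w : V₁) :
      Q x (Submodule.Quotient.mk w) = P (x : V₀) w := rfl
  have hsurj : Function.Surjective Q.flip := by
    intro f
    obtain ⟨w, hw⟩ := hP'.2 (f ∘ₗ (LinearMap.range v₀).projectionOnto C hC)
    refine ⟨Submodule.Quotient.mk w, LinearMap.ext fun x ↦ ?_⟩
    have := LinearMap.congr_fun hw (x : V₀)
    simpa [hQ] using this
  have : Module.Free ℤ (V₁ ⧸ LinearMap.range v₁) :=
    .of_equiv (Submodule.quotientEquivOfIsCompl _ D hD).symm
  have hrk : Module.finrank ℤ (V₁ ⧸ LinearMap.range v₁) =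
      Module.finrank ℤ (Module.Dual ℤ (LinearMap.range v₀)) := by
    have h₀ := (LinearEquiv.ofInjective v₀ h₀inj).finrank_eq
    have h₁ := (LinearEquiv.ofInjective v₁ h₁inj).finrank_eq
    have h := Submodule.finrank_quotient_add_finrank (LinearMap.range v₁)
    have hd : Module.finrank ℤ (Module.Dual ℤ (LinearMap.range v₀)) =
        Module.finrank ℤ (LinearMap.range v₀) := Module.finrank_linearMap_self ..
    omega
  have hbij := Q.flip.bijective_of_surjective_of_finrank_eq_of_free hsurj hrk
  have hperf := LinearMap.IsPerfPair.of_bijective Q.flip hbij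
  exact ⟨Q, hQ, hperf.bijective_right, hbij⟩
end

section
/- Let α₁, α₂ : S³ → ℝ⁴ be continuous maps with ‖α₁(x)‖ = ‖α₂(x)‖ = 1 and ⟨α₁(x), α₂(x)⟩ = 0 for every x ∈ S³ (i.e. α = (α₁, α₂) is a continuous map from S³ to the Stiefel manifold V_{4,2} of orthonormal 2-frames in ℝ⁴). Then the map τ_α : S¹ × S³ → ℝ⁴ × ℝ⁴ defined by τ_α((s, t), x) = (x, s·α₁(x) + t·α₂(x)) / √2 takes all its values in the unit sphere S⁷ of ℝ⁴ × ℝ⁴, is injective, and is a topological embedding (a homeomorphism onto its image). -/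
open scoped InnerProductSpace

section OrthonormalPair

variable {E : Type*} [NormedAddCommGroup E] [InnerProductSpace ℝ E] {u v : E}

theorem inner_left_smul_add_smul (hu : ‖u‖ = 1) (huv : ⟪u, v⟫_ℝ = 0) (s t : ℝ) :
    ⟪u, s • u + t • v⟫_ℝ = s := by
  simp [inner_add_right, inner_smul_right, huv, hu]

theorem inner_right_smul_add_smul (hv : ‖v‖ = 1) (huv : ⟪u, v⟫_ℝ = 0) (s t : ℝ) :
    ⟪v, s • u + t • v⟫_ℝ = t := by
  simp [inner_add_right, inner_smul_right, real_inner_comm u v ▸ huv, hv]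

theorem norm_sq_smul_add_smul (hu : ‖u‖ = 1) (hv : ‖v‖ = 1) (huv : ⟪u, v⟫_ℝ = 0) (s t : ℝ) :
    ‖s • u + t • v‖ ^ 2 = s ^ 2 + t ^ 2 := by
  rw [← real_inner_self_eq_norm_sq, inner_add_left, inner_smul_left, inner_smul_left,
    inner_left_smul_add_smul hu huv, inner_right_smul_add_smul hv huv]
  simp only [conj_trivial]
  ring

end OrthonormalPair

/-- Section 1.2: for a continuous map `α = (α₁, α₂) : S³ → V_{4,2}` (orthonormal 2-frames in
`ℝ⁴`), the map `τ_α : S¹ × S³ → ℝ⁴ × ℝ⁴`, `((s,t), x) ↦ (x, s•α₁ x + t•α₂ x)/√2`, takes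
values in the unit sphere `S⁷`, is injective and is a topological embedding. -/
theorem stmt10
    (α₁ α₂ : (Metric.sphere (0 : EuclideanSpace ℝ (Fin 4)) 1) → EuclideanSpace ℝ (Fin 4))
    (hc₁ : Continuous α₁) (hc₂ : Continuous α₂)
    (hn₁ : ∀ x, ‖α₁ x‖ = 1) (hn₂ : ∀ x, ‖α₂ x‖ = 1)
    (horth : ∀ x, ⟪α₁ x, α₂ x⟫_ℝ = 0)
    (f : (Metric.sphere (0 : EuclideanSpace ℝ (Fin 2)) 1 ×
          Metric.sphere (0 : EuclideanSpace ℝ (Fin 4)) 1) →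
        WithLp 2 (EuclideanSpace ℝ (Fin 4) × EuclideanSpace ℝ (Fin 4)))
    (hf : ∀ p, f p = (Real.sqrt 2)⁻¹ •
        (WithLp.equiv 2 (EuclideanSpace ℝ (Fin 4) × EuclideanSpace ℝ (Fin 4))).symm
          ((p.2 : EuclideanSpace ℝ (Fin 4)),
            (p.1 : EuclideanSpace ℝ (Fin 2)) 0 • α₁ p.2 +
              (p.1 : EuclideanSpace ℝ (Fin 2)) 1 • α₂ p.2)) :
    (∀ p, f p ∈
        Metric.sphere (0 : WithLp 2 (EuclideanSpace ℝ (Fin 4) × EuclideanSpace ℝ (Fin 4))) 1) ∧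
    Function.Injective f ∧ Topology.IsEmbedding f := by
  have hcont : Continuous f := by
    rw [funext hf]
    simp only [WithLp.equiv_symm_apply]
    fun_prop
  have hinj : Function.Injective f := by
    rintro ⟨a, x⟩ ⟨b, y⟩ h
    rw [hf, hf] at h
    have h' := (WithLp.equiv 2 _).symm.injective
      (smul_right_injective _ (inv_ne_zero (Real.sqrt_ne_zero'.2 two_pos)) h)
    obtain ⟨hxy, hab⟩ := Prod.ext_iff.1 h'
    obtain rfl : x = y := Subtype.ext hxy
    have h₀ := congrArg (fun w => ⟪α₁ x, w⟫_ℝ) hab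
    have h₁ := congrArg (fun w => ⟪α₂ x, w⟫_ℝ) hab
    simp only [inner_left_smul_add_smul (hn₁ x) (horth x)] at h₀
    simp only [inner_right_smul_add_smul (hn₂ x) (horth x)] at h₁
    refine Prod.ext (Subtype.ext ?_) rfl
    ext i
    fin_cases i
    · exact h₀
    · exact h₁
  refine ⟨fun p => ?_, hinj, (hcont.isClosedEmbedding hinj).isEmbedding⟩
  have hp₁ : (p.1 : EuclideanSpace ℝ (Fin 2)) 0 ^ 2 +
      (p.1 : EuclideanSpace ℝ (Fin 2)) 1 ^ 2 = 1 := by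
    have h := EuclideanSpace.real_norm_sq_eq (p.1 : EuclideanSpace ℝ (Fin 2))
    rw [norm_eq_of_mem_sphere p.1, Fin.sum_univ_two] at h
    linarith
  rw [mem_sphere_zero_iff_norm, ← sq_eq_sq₀ (norm_nonneg _) zero_le_one, hf, norm_smul, mul_pow,
    WithLp.prod_norm_sq_eq_of_L2]
  simp only [WithLp.equiv_symm_apply, WithLp.toLp_fst, WithLp.toLp_snd]
  rw [norm_sq_smul_add_smul (hn₁ _) (hn₂ _) (horth _), hp₁, norm_eq_of_mem_sphere p.2]
  norm_num
end

section
/- Let ℍ denote the real quaternions, S³ = {y ∈ ℍ : ‖y‖ = 1}, and let η : S³ → ℍ be the quaternionic Hopf map η(y) = y·i·(conjugate of y), which takes values in the unit purely imaginary quaternions. Then the map S¹ × S³ → ℍ × ℍ sending ((cos θ, sin θ), y) to (cos θ · η(y) + sin θ, y)/√2 takes all its values in the unit sphere S⁷ of ℍ × ℍ, is injective, and is a topological embedding (a homeomorphism onto its image). -/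
/-- The quaternion `i`. -/
noncomputable def quatI : Quaternion ℝ := ⟨0, 1, 0, 0⟩

theorem re_hopf (y : Quaternion ℝ) : (y * quatI * star y).re = 0 := by
  simp only [Quaternion.re_mul, Quaternion.imI_mul, Quaternion.imJ_mul, Quaternion.imK_mul,
    Quaternion.re_star, Quaternion.imI_star, Quaternion.imJ_star, Quaternion.imK_star]
  simp only [quatI]
  ring

theorem norm_quatI : ‖quatI‖ = 1 := by
  have h : ‖quatI‖ * ‖quatI‖ = 1 := by
    rw [← Quaternion.normSq_eq_norm_mul_self, Quaternion.normSq_def']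
    norm_num [quatI]
  nlinarith [norm_nonneg quatI]

theorem norm_hopf {y : Quaternion ℝ} (hy : ‖y‖ = 1) : ‖y * quatI * star y‖ = 1 := by
  simp [norm_quatI, hy]

/-- Real and purely imaginary quaternions are orthogonal. -/
theorem norm_smul_add_coe_sq {h : Quaternion ℝ} (hre : h.re = 0) (c s : ℝ) :
    ‖c • h + (s : Quaternion ℝ)‖ ^ 2 = c ^ 2 * ‖h‖ ^ 2 + s ^ 2 := by
  rw [sq ‖_‖, sq ‖h‖, ← Quaternion.normSq_eq_norm_mul_self,
    ← Quaternion.normSq_eq_norm_mul_self, Quaternion.normSq_def', Quaternion.normSq_def']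
  simp [hre]
  ring

theorem smul_add_coe_injective {h : Quaternion ℝ} (hre : h.re = 0) (h0 : h ≠ 0) {c s c' s' : ℝ}
    (e : c • h + (s : Quaternion ℝ) = c' • h + (s' : Quaternion ℝ)) : c = c' ∧ s = s' := by
  have hs : s = s' := by simpa [hre] using congrArg QuaternionAlgebra.re e
  subst hs
  exact ⟨smul_left_injective ℝ h0 (add_right_cancel e), rfl⟩

theorem compactSpace_unitQuaternion : CompactSpace {y : Quaternion ℝ // ‖y‖ = 1} := by
  have : ProperSpace (Quaternion ℝ) := FiniteDimensional.proper ℝ _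
  have h : IsCompact {y : Quaternion ℝ | ‖y‖ = 1} := by
    convert isCompact_sphere (0 : Quaternion ℝ) 1 using 1
    ext y
    simp
  exact isCompact_iff_compactSpace.mp h

/-- Remark 1.10, the map `T²`: with `η(y) = y·i·(conj y)` the quaternionic Hopf map, the map
`S¹ × S³ → ℍ × ℍ` sending `((cos θ, sin θ), y)` to `(cos θ · η(y) + sin θ, y)/√2` takes
values in the unit sphere `S⁷` of `ℍ × ℍ` (with the Euclidean norm), is injective and is a
topological embedding. -/
theorem stmt12
    (f : (Metric.sphere (0 : EuclideanSpace ℝ (Fin 2)) 1 ×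
          {y : Quaternion ℝ // ‖y‖ = 1}) → WithLp 2 (Quaternion ℝ × Quaternion ℝ))
    (hf : ∀ p, f p = (Real.sqrt 2)⁻¹ •
        (WithLp.equiv 2 (Quaternion ℝ × Quaternion ℝ)).symm
          (((p.1 : EuclideanSpace ℝ (Fin 2)) 0) •
              ((p.2 : Quaternion ℝ) * quatI * star (p.2 : Quaternion ℝ))
            + (((p.1 : EuclideanSpace ℝ (Fin 2)) 1 : ℝ) : Quaternion ℝ),
           (p.2 : Quaternion ℝ))) :
    (∀ p, f p ∈ Metric.sphere (0 : WithLp 2 (Quaternion ℝ × Quaternion ℝ)) 1) ∧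
    Function.Injective f ∧ Topology.IsEmbedding f := by
  have h2 : (Real.sqrt 2)⁻¹ ≠ 0 := by positivity
  have hcont : Continuous f := by
    rw [funext hf]
    refine (continuous_const_smul (Real.sqrt 2)⁻¹).comp
      ((WithLp.prod_continuous_toLp 2 (Quaternion ℝ) (Quaternion ℝ)).comp ?_)
    have hcoe : Continuous ((↑) : ℝ → Quaternion ℝ) := Quaternion.continuous_coe
    fun_prop
  have hinj : Function.Injective f := by
    rintro ⟨x, y⟩ ⟨x', y'⟩ e
    rw [hf, hf] at e
    have e' := (WithLp.equiv 2 (Quaternion ℝ × Quaternion ℝ)).symm.injective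
      (smul_right_injective _ h2 e)
    obtain ⟨e₁, e₂⟩ := Prod.mk.inj e'
    obtain rfl : y = y' := Subtype.ext e₂
    have h0 : (y : Quaternion ℝ) * quatI * star (y : Quaternion ℝ) ≠ 0 := by
      rw [← norm_ne_zero_iff, norm_hopf y.2]
      exact one_ne_zero
    obtain ⟨hc, hs⟩ := smul_add_coe_injective (re_hopf y) h0 e₁
    refine Prod.ext (Subtype.ext ?_) rfl
    ext i
    fin_cases i
    · exact hc
    · exact hs
  have := compactSpace_unitQuaternion
  refine ⟨fun p => ?_, hinj, (hcont.isClosedEmbedding hinj).isEmbedding⟩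
  have hx : (p.1 : EuclideanSpace ℝ (Fin 2)) 0 ^ 2 + (p.1 : EuclideanSpace ℝ (Fin 2)) 1 ^ 2 = 1 := by
    have h := EuclideanSpace.real_norm_sq_eq (p.1 : EuclideanSpace ℝ (Fin 2))
    rw [mem_sphere_zero_iff_norm.mp p.1.2, Fin.sum_univ_two] at h
    linarith
  rw [mem_sphere_zero_iff_norm, hf, norm_smul, WithLp.prod_norm_eq_of_L2]
  simp only [WithLp.equiv_symm_apply, WithLp.toLp_fst, WithLp.toLp_snd]
  rw [norm_smul_add_coe_sq (re_hopf _), norm_hopf p.2.2, p.2.2, one_pow, mul_one, hx,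
    one_add_one_eq_two, norm_inv, Real.norm_of_nonneg (Real.sqrt_nonneg 2)]
  exact inv_mul_cancel₀ (by positivity)
end

section
/- Let S be a finitely generated free abelian group with a unimodular symmetric bilinear form B : S × S → ℤ, and let U ⊆ S be a direct summand such that B(u, u') = 0 for all u, u' ∈ U. Then there exists a subgroup T with U ⊆ T ⊆ S such that rank T = 2 · rank U and the restriction of B to T is unimodular. -/
/-- Proof of the Elementary Pair Lemma 4.3: a totally isotropic direct summand `U` of a
unimodular symmetric lattice `(S, B)` is contained in a subgroup `T` of rank `2 · rank U`
on which `B` restricts to a unimodular form. -/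
theorem stmt13 (S : Type) [AddCommGroup S] [Module.Free ℤ S] [Module.Finite ℤ S]
    (B : S →ₗ[ℤ] S →ₗ[ℤ] ℤ)
    (hBsymm : ∀ x y : S, B x y = B y x)
    (hB : Function.Bijective B)
    (U : Submodule ℤ S)
    (hUsum : ∃ C : Submodule ℤ S, IsCompl U C)
    (hUiso : ∀ u ∈ U, ∀ u' ∈ U, B u u' = 0) :
    ∃ T : Submodule ℤ S, U ≤ T ∧
      Module.finrank ℤ ↥T = 2 * Module.finrank ℤ ↥U ∧
      Function.Bijective (B.domRestrict₁₂ T T) := by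
  obtain ⟨C, hC⟩ := hUsum
  -- `s` sends a functional on `U`, extended by zero on `C`, to the vector representing it.
  let s : Module.Dual ℤ U →ₗ[ℤ] S :=
    (LinearEquiv.ofBijective B hB).symm.toLinearMap ∘ₗ (U.projectionOnto C hC).dualMap
  have hs : ∀ (f : Module.Dual ℤ U) (u : U), B (s f) u = f u := by
    intro f u
    have h : B (s f) = (U.projectionOnto C hC).dualMap f :=
      (LinearEquiv.ofBijective B hB).apply_symm_apply _
    rw [h, LinearMap.dualMap_apply, Submodule.projectionOnto_apply_left]
  let g : (U × Module.Dual ℤ U) →ₗ[ℤ] S := U.subtype.coprod s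
  have hg : ∀ u f, g (u, f) = (u : S) + s f := fun u f => rfl
  have hgu : ∀ (u : U) f (u' : U), B (g (u, f)) u' = f u' := by
    intro u f u'
    rw [hg, map_add, LinearMap.add_apply, hUiso u u.2 u' u'.2, hs, zero_add]
  have hgs : ∀ (u : U) f f', B (g (u, f)) (s f') = f' u + B (s f) (s f') := by
    intro u f f'
    rw [hg, map_add, LinearMap.add_apply, hBsymm u, hs]
  have hU : ∀ u : U, (u : S) ∈ LinearMap.range g := fun u => ⟨(u, 0), by simp [hg]⟩
  have hS : ∀ f, s f ∈ LinearMap.range g := fun f => ⟨(0, f), by simp [hg]⟩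
  have key : ∀ u f, (∀ t ∈ LinearMap.range g, B (g (u, f)) t = 0) → u = 0 ∧ f = 0 := by
    intro u f h
    have hf : f = 0 := by
      ext u'
      rw [← hgu u f u', h _ (hU u'), LinearMap.zero_apply]
    subst hf
    refine ⟨(Module.forall_dual_apply_eq_zero_iff ℤ u).1 fun f' => ?_, rfl⟩
    have h' := h _ (hS f')
    rwa [hgs, map_zero, map_zero, LinearMap.zero_apply, add_zero] at h'
  have hginj : Function.Injective g := by
    rw [injective_iff_map_eq_zero]
    rintro ⟨u, f⟩ h
    obtain ⟨rfl, rfl⟩ := key u f fun t _ => by rw [h, map_zero, LinearMap.zero_apply]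
    rfl
  refine ⟨LinearMap.range g, fun u hu => hU ⟨u, hu⟩, ?_, ?_, ?_⟩
  · rw [LinearMap.finrank_range_of_inj hginj, Module.finrank_prod,
      ← (Module.Free.chooseBasis ℤ U).toDualEquiv.finrank_eq]
    ring
  · rw [injective_iff_map_eq_zero]
    rintro ⟨_, ⟨u, f⟩, rfl⟩ h
    obtain ⟨rfl, rfl⟩ := key u f fun t ht => LinearMap.congr_fun h ⟨t, ht⟩
    exact Subtype.ext (map_zero g)
  · intro φ
    let f : Module.Dual ℤ U := φ ∘ₗ U.subtype.codRestrict _ hU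
    let ψ : Module.Dual ℤ (Module.Dual ℤ U) := φ ∘ₗ s.codRestrict _ hS - B (s f) ∘ₗ s
    obtain ⟨u, hu⟩ := (Module.bijective_dual_eval ℤ U).2 ψ
    have hu' : ∀ f', f' u = φ ⟨s f', hS f'⟩ - B (s f) (s f') := LinearMap.congr_fun hu
    refine ⟨⟨g (u, f), LinearMap.mem_range_self g _⟩, ?_⟩
    ext ⟨_, ⟨u', f'⟩, rfl⟩
    have ht : (⟨g (u', f'), LinearMap.mem_range_self g _⟩ : LinearMap.range g) =
        ⟨u', hU u'⟩ + ⟨s f', hS f'⟩ := rfl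
    calc B (g (u, f)) (g (u', f')) = f u' + (f' u + B (s f) (s f')) := by
          rw [hg u' f', map_add, hgu, hgs]
      _ = φ ⟨u', hU u'⟩ + φ ⟨s f', hS f'⟩ := by rw [hu', sub_add_cancel]; rfl
      _ = _ := by rw [ht, map_add]
end
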